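/- Let G = ⟨a,b_1,…,b_r⟩ be a multi-GGS-group with r ≥ 2. Then the second derived subgroup contains a level stabilizer: G″ ≥ st_G(r+3). -/

import Mathlib

/-!
Automorphisms of the `p`-regular rooted tree, encoded by portraits:
an automorphism is a family of permutations of `Fin p`, one for each vertex
(vertices are finite words over `Fin p`, the root being `[]`).
-/

namespace TreeAut

variable {p : ℕ}

/-- Automorphisms of the `p`-regular rooted tree, given by their portraits. -/
def AutT (p : ℕ) : Type := List (Fin p) → Equiv.Perm (Fin p)

namespace AutT

/-- The action of a tree automorphism on the vertices (finite words over `Fin p`). -/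
def act : AutT p → List (Fin p) → List (Fin p)
  | _, [] => []
  | f, x :: w => f [] x :: act (fun v => f (x :: v)) w

/-- The section of `f` at the level-one vertex `x`; the map
`f ↦ (sections f 0, …, sections f (p-1))` restricted to the first-level
stabilizer is the isomorphism `ψ`. -/
def sections (f : AutT p) : Fin p → AutT p := fun x v => f (x :: v)

instance : One (AutT p) := ⟨fun _ => 1⟩

instance : Mul (AutT p) := ⟨fun f g v => f (act g v) * g v⟩

/-- The action of the inverse automorphism on vertices. -/
def invAct : AutT p → List (Fin p) → List (Fin p)
  | _, [] => []
  | f, x :: w => (f [])⁻¹ x :: invAct (fun v => f (((f [])⁻¹ x) :: v)) w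

instance : Inv (AutT p) := ⟨fun f v => (f (invAct f v))⁻¹⟩

lemma one_apply (v : List (Fin p)) : (1 : AutT p) v = 1 := rfl

lemma mul_apply (f g : AutT p) (v : List (Fin p)) : (f * g) v = f (act g v) * g v := rfl

lemma inv_apply (f : AutT p) (v : List (Fin p)) : f⁻¹ v = (f (invAct f v))⁻¹ := rfl

lemma act_nil (f : AutT p) : act f [] = [] := rfl

lemma act_cons (f : AutT p) (x : Fin p) (w : List (Fin p)) :
    act f (x :: w) = f [] x :: act (sections f x) w := rfl

lemma sections_mul (f g : AutT p) (x : Fin p) :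
    sections (f * g) x = sections f (g [] x) * sections g x :=
  funext fun _ => rfl

lemma act_one : ∀ v : List (Fin p), act (1 : AutT p) v = v
  | [] => rfl
  | x :: w => congrArg (x :: ·) (act_one w)

lemma act_mul (f g : AutT p) : ∀ v : List (Fin p), act (f * g) v = act f (act g v)
  | [] => rfl
  | x :: w => by
      rw [act_cons (f * g), sections_mul, act_mul, act_cons g, act_cons f]
      rfl

lemma invAct_act (f : AutT p) : ∀ v : List (Fin p), invAct f (act f v) = v
  | [] => rfl
  | x :: w => by
      rw [act_cons]
      show (f [])⁻¹ (f [] x) ::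
          invAct (fun v => f (((f [])⁻¹ (f [] x)) :: v)) (act (sections f x) w) = x :: w
      have h : (f [])⁻¹ (f [] x) = x := Equiv.symm_apply_apply (f []) x
      rw [h]
      exact congrArg (x :: ·) (invAct_act (sections f x) w)

instance : Group (AutT p) where
  mul_assoc f g h := by
    funext v
    show (f * g) (act h v) * h v = f (act (g * h) v) * (g * h) v
    rw [mul_apply, mul_apply, act_mul, mul_assoc]
  one_mul f := by
    funext v
    show (1 : AutT p) (act f v) * f v = f v
    rw [one_apply, one_mul]
  mul_one f := by
    funext v
    show f (act (1 : AutT p) v) * (1 : AutT p) v = f v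
    rw [act_one, one_apply, mul_one]
  inv_mul_cancel f := by
    funext v
    show f⁻¹ (act f v) * f v = (1 : AutT p) v
    rw [inv_apply, invAct_act, one_apply, inv_mul_cancel]

lemma act_length (f : AutT p) : ∀ v : List (Fin p), (act f v).length = v.length
  | [] => rfl
  | _ :: w => congrArg Nat.succ (act_length _ w)

lemma act_act_inv (f : AutT p) (v : List (Fin p)) : act f (act f⁻¹ v) = v := by
  rw [← act_mul, mul_inv_cancel, act_one]

/-- The pointwise stabilizer `st(n)` of the `n`-th level of the tree. -/
def levelStab (p n : ℕ) : Subgroup (AutT p) where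
  carrier := {f | ∀ v : List (Fin p), v.length = n → act f v = v}
  one_mem' := fun v _ => act_one v
  mul_mem' := by
    intro f g hf hg v hv
    rw [act_mul, hg v hv, hf v hv]
  inv_mem' := by
    intro f hf v hv
    have h1 : act f (act f⁻¹ v) = v := act_act_inv f v
    have h2 : act f (act f⁻¹ v) = act f⁻¹ v := hf _ (by rw [act_length, hv])
    exact h2.symm.trans h1

instance levelStab_normal (p n : ℕ) : (levelStab p n).Normal := by
  constructor
  intro f hf g v hv
  show act (g * f * g⁻¹) v = v
  rw [act_mul, act_mul, hf _ (by rw [act_length, hv]), act_act_inv]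

/-- The tuple of sections at the level-two vertices.  Restricted to the
second-level stabilizer this is the map `ψ₂`. -/
def sections2 (f : AutT p) : Fin p → Fin p → AutT p := fun x y v => f (x :: y :: v)

/-- The rooted automorphism defined by a permutation `σ` of `Fin p`. -/
def rooted (σ : Equiv.Perm (Fin p)) : AutT p := fun v => if v = [] then σ else 1

/-- The rooted automorphism `a`, acting at the root by the cycle `(1 2 … p)`. -/
def rootedA (p : ℕ) : AutT p := rooted (finRotate p)

/-- Auxiliary portrait for the directed automorphism `b_e`. -/
def directedAux (e : Fin (p - 1) → ZMod p) : List (Fin p) → Equiv.Perm (Fin p)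
  | [] => 1
  | x :: w =>
      if h : (x : ℕ) < p - 1 then
        (if w = [] then finRotate p ^ ((e ⟨x, h⟩).val) else 1)
      else directedAux e w

/-- The directed automorphism `b_e` defined by the vector `e ∈ 𝔽_p^{p-1}`,
i.e. the unique automorphism with `ψ(b_e) = (a^{e_1}, …, a^{e_{p-1}}, b_e)`. -/
def directed (e : Fin (p - 1) → ZMod p) : AutT p := directedAux e

/-- The multi-GGS-group determined by the vectors `e 1, …, e r`. -/
def multiGGS (p : ℕ) {r : ℕ} (e : Fin r → Fin (p - 1) → ZMod p) : Subgroup (AutT p) :=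
  Subgroup.closure ({rootedA p} ∪ Set.range fun i => directed (e i))

/-- The GGS-group `𝒢` defined by the (nonzero) constant vector `(c, …, c)`. -/
def constGGS (p : ℕ) (c : ZMod p) : Subgroup (AutT p) :=
  Subgroup.closure {rootedA p, directed (fun _ => c)}

/-- `G` is the GGS-group `𝒢` defined by a constant vector. -/
def IsConstGGS {p : ℕ} (G : Subgroup (AutT p)) : Prop :=
  ∃ c : ZMod p, c ≠ 0 ∧ G = constGGS p c

/-- The stabilizer `st_G(n) = G ∩ st(n)`, viewed as a subgroup of `G`. -/
def stabIn {p : ℕ} (G : Subgroup (AutT p)) (n : ℕ) : Subgroup G :=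
  (levelStab p n).comap G.subtype

instance {p : ℕ} (G : Subgroup (AutT p)) (n : ℕ) : (stabIn G n).Normal :=
  Subgroup.Normal.comap (levelStab_normal p n) G.subtype

/-- The congruence subgroup property: every finite-index subgroup of `G`
contains a level stabilizer `st_G(n)`. -/
def HasCSP {p : ℕ} (G : Subgroup (AutT p)) : Prop :=
  ∀ H : Subgroup G, H.FiniteIndex → ∃ n : ℕ, stabIn G n ≤ H

/-- `G` is just infinite: it is infinite and all its nontrivial normal
subgroups have finite index. -/
def JustInfinite {p : ℕ} (G : Subgroup (AutT p)) : Prop :=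
  Infinite G ∧ ∀ N : Subgroup G, N.Normal → N ≠ ⊥ → N.FiniteIndex

end AutT

end TreeAut

open TreeAut AutT Subgroup

namespace TreeAut

namespace AutT

open scoped commutatorElement

section Basic

variable {p : ℕ}

lemma ext_sections {f g : AutT p} (h0 : f [] = g []) (h : ∀ x, sections f x = sections g x) :
    f = g := by
  funext v
  cases v with
  | nil => exact h0
  | cons x w => exact congrFun (h x) w

lemma root_one : (1 : AutT p) [] = 1 := rfl

lemma root_mul (f g : AutT p) : (f * g) [] = f [] * g [] := rfl

lemma root_inv (f : AutT p) : f⁻¹ [] = (f [])⁻¹ := rfl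

lemma sections_one (x : Fin p) : sections (1 : AutT p) x = 1 := rfl

lemma sections_inv (f : AutT p) (x : Fin p) :
    sections f⁻¹ x = (sections f ((f [])⁻¹ x))⁻¹ := by
  have h := sections_mul f f⁻¹ x
  rw [mul_inv_cancel, sections_one, root_inv] at h
  exact (inv_eq_of_mul_eq_one_right h.symm).symm

lemma sections_inv_of_root {f : AutT p} (hf : f [] = 1) (x : Fin p) :
    sections f⁻¹ x = (sections f x)⁻¹ := by
  rw [sections_inv, hf]; rfl

lemma sections_mul_of_root (f : AutT p) {g : AutT p} (hg : g [] = 1) (x : Fin p) :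
    sections (f * g) x = sections f x * sections g x := by
  rw [sections_mul, hg]; rfl

/-- Taking the permutation induced on the first level is a homomorphism. -/
def rootHom (p : ℕ) : AutT p →* Equiv.Perm (Fin p) where
  toFun f := f []
  map_one' := rfl
  map_mul' _ _ := rfl

lemma rootHom_apply (f : AutT p) : rootHom p f = f [] := rfl

/-- The automorphism fixing the first level with prescribed sections. -/
def ofSections (s : Fin p → AutT p) : AutT p
  | [] => 1
  | x :: w => s x w

lemma root_ofSections (s : Fin p → AutT p) : ofSections s [] = 1 := rfl

lemma ofSections_sections {f : AutT p} (hf : f [] = 1) : ofSections (sections f) = f :=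
  ext_sections hf.symm fun _ => rfl

/-- The inverse of `ψ`, as a homomorphism into the automorphism group of the tree. -/
def psiInv (p : ℕ) : (Fin p → AutT p) →* AutT p where
  toFun := ofSections
  map_one' := ext_sections rfl fun _ => rfl
  map_mul' s t := by
    refine ext_sections rfl fun x => ?_
    rw [sections_mul_of_root _ (root_ofSections t)]
    rfl

/-- The automorphism acting as `g` below the level-one vertex `x` and trivially elsewhere. -/
def atPos (x : Fin p) : AutT p →* AutT p :=
  (psiInv p).comp (MonoidHom.mulSingle (fun _ => AutT p) x)

lemma root_atPos (x : Fin p) (g : AutT p) : atPos x g [] = 1 := rfl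

lemma sections_atPos (x y : Fin p) (g : AutT p) :
    sections (atPos x g) y = Pi.mulSingle (M := fun _ => AutT p) x g y := rfl

lemma mem_of_atPos_mem {H : Subgroup (AutT p)} {f : AutT p} (hf : f [] = 1)
    (h : ∀ x, atPos x (sections f x) ∈ H) : f ∈ H := by
  rw [← ofSections_sections hf]
  exact Subgroup.pi_mem_of_mulSingle_mem (H := H.comap (psiInv p)) (sections f) h

lemma eq_atPos {f : AutT p} {x : Fin p} {g : AutT p} (hf : f [] = 1) (hx : sections f x = g)
    (h : ∀ y, y ≠ x → sections f y = 1) : f = atPos x g := by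
  refine ext_sections hf fun y => ?_
  rw [sections_atPos]
  by_cases hy : y = x
  · subst hy; rw [hx, Pi.mulSingle_eq_same]
  · rw [h y hy, Pi.mulSingle_eq_of_ne hy]

lemma conj_atPos {h : AutT p} (hh : h [] = 1) (x : Fin p) (g : AutT p) :
    h * atPos x g * h⁻¹ = atPos x (sections h x * g * (sections h x)⁻¹) := by
  have hi : h⁻¹ [] = 1 := by rw [root_inv, hh, inv_one]
  have key : ∀ y, sections (h * atPos x g * h⁻¹) y =
      sections h y * sections (atPos x g) y * (sections h y)⁻¹ := fun y => by
    rw [sections_mul_of_root _ hi, sections_mul_of_root _ (root_atPos x g),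
      sections_inv_of_root hh]
  refine eq_atPos ?_ ?_ fun y hy => ?_
  · rw [root_mul, root_mul, root_atPos, hh, hi, one_mul, one_mul]
  · rw [key, sections_atPos, Pi.mulSingle_eq_same]
  · rw [key, sections_atPos, Pi.mulSingle_eq_of_ne hy, mul_one, mul_inv_cancel]

lemma commutator_atPos {h : AutT p} (hh : h [] = 1) (x : Fin p) (g : AutT p) :
    ⁅atPos x g, h⁆ = atPos x ⁅g, sections h x⁆ := by
  have e : ⁅atPos x g, h⁆ = atPos x g * (h * atPos x g * h⁻¹)⁻¹ := by
    rw [commutatorElement_def]; group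
  rw [e, conj_atPos hh, ← map_inv, ← map_mul, commutatorElement_def]
  congr 1
  group

lemma root_commutator {f : AutT p} (hf : f [] = 1) (g : AutT p) : ⁅f, g⁆ [] = 1 := by
  have h := map_commutatorElement (rootHom p) f g
  rwa [rootHom_apply, rootHom_apply f, hf, commutatorElement_one_left] at h

lemma sections_commutator {f g : AutT p} (hf : f [] = 1) (hg : g [] = 1) (x : Fin p) :
    sections ⁅f, g⁆ x = ⁅sections f x, sections g x⁆ := by
  have hfi : f⁻¹ [] = 1 := by rw [root_inv, hf, inv_one]
  have hgi : g⁻¹ [] = 1 := by rw [root_inv, hg, inv_one]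
  rw [commutatorElement_def, commutatorElement_def, sections_mul_of_root _ hgi,
    sections_mul_of_root _ hfi, sections_mul_of_root _ hg, sections_inv_of_root hf,
    sections_inv_of_root hg]

lemma root_eq_one_of_mem_levelStab [NeZero p] {n : ℕ} {f : AutT p}
    (hf : f ∈ levelStab p (n + 1)) : f [] = 1 := by
  ext x : 1
  have h := hf (x :: List.replicate n 0) (by simp)
  rw [act_cons] at h
  exact (List.cons.inj h).1

lemma sections_mem_levelStab {n : ℕ} {f : AutT p} (hf : f ∈ levelStab p (n + 1)) (x : Fin p) :
    sections f x ∈ levelStab p n := by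
  intro v hv
  have h := hf (x :: v) (by simp [hv])
  rw [act_cons] at h
  exact (List.cons.inj h).2

lemma sections_rooted (σ : Equiv.Perm (Fin p)) (x : Fin p) : sections (rooted σ) x = 1 := rfl

lemma rooted_mul (σ τ : Equiv.Perm (Fin p)) : rooted (σ * τ) = rooted σ * rooted τ :=
  ext_sections rfl fun x => by
    rw [sections_mul, sections_rooted, sections_rooted, sections_rooted, one_mul]

lemma rooted_one : rooted (1 : Equiv.Perm (Fin p)) = 1 :=
  ext_sections rfl fun _ => rfl

end Basic

section Rotations

variable {p : ℕ} [NeZero p]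

/-- The additive identification of the residues modulo `p` with the level-one vertices. -/
def vertex (p : ℕ) [NeZero p] : ZMod p ≃+ Fin p := (ZMod.finEquiv p).symm.toAddEquiv

/-- The rotation of the first level by `c`. -/
def rot (c : ZMod p) : Equiv.Perm (Fin p) := Equiv.addRight (vertex p c)

lemma rot_apply (c : ZMod p) (i : Fin p) : rot c i = i + vertex p c := rfl

lemma rot_zero : rot (0 : ZMod p) = 1 := by
  ext i : 1
  rw [rot_apply, map_zero, add_zero]; rfl

lemma rot_add (c d : ZMod p) : rot (c + d) = rot c * rot d := by
  ext i : 1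
  rw [Equiv.Perm.mul_apply, rot_apply, rot_apply, rot_apply, map_add, add_comm (vertex p c),
    add_assoc]

lemma rot_eq_one {c : ZMod p} (h : rot c = 1) : c = 0 := by
  have h0 : rot c 0 = 0 := by rw [h]; rfl
  rw [rot_apply, zero_add] at h0
  exact (map_eq_zero_iff _ (vertex p).injective).1 h0

lemma rot_one : rot (1 : ZMod p) = finRotate p := by
  ext i : 1
  rw [rot_apply, finRotate_apply]
  congr 1
  exact map_one (ZMod.finEquiv p).symm

lemma rot_natCast (n : ℕ) : rot (n : ZMod p) = finRotate p ^ n := by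
  induction n with
  | zero => rw [Nat.cast_zero, rot_zero, pow_zero]
  | succ n ih => rw [Nat.cast_succ, rot_add, ih, rot_one, pow_succ]

lemma finRotate_pow_val (c : ZMod p) : finRotate p ^ c.val = rot c := by
  rw [← rot_natCast, ZMod.natCast_zmod_val]

/-- The power `a ^ c` of the rooted automorphism. -/
def rotA (c : ZMod p) : AutT p := rooted (rot c)

lemma root_rotA (c : ZMod p) : rotA c [] = rot c := rfl

lemma sections_rotA (c : ZMod p) (x : Fin p) : sections (rotA c) x = 1 := rfl

lemma rotA_zero : rotA (0 : ZMod p) = 1 := by rw [rotA, rot_zero, rooted_one]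

lemma rotA_add (c d : ZMod p) : rotA (c + d) = rotA c * rotA d := by
  rw [rotA, rot_add, rooted_mul]; rfl

lemma rotA_neg (c : ZMod p) : rotA (-c) = (rotA c)⁻¹ := by
  rw [eq_inv_iff_mul_eq_one, ← rotA_add, neg_add_cancel, rotA_zero]

lemma rotA_one : rotA (1 : ZMod p) = rootedA p := by rw [rotA, rot_one]; rfl

lemma rotA_natCast (n : ℕ) : rotA (n : ZMod p) = rootedA p ^ n := by
  induction n with
  | zero => rw [Nat.cast_zero, rotA_zero, pow_zero]
  | succ n ih => rw [Nat.cast_succ, rotA_add, ih, rotA_one, pow_succ]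

lemma root_conj_rotA {f : AutT p} (hf : f [] = 1) (c : ZMod p) :
    (rotA c * f * (rotA c)⁻¹) [] = 1 := by
  rw [root_mul, root_mul, root_inv, hf, mul_one, mul_inv_cancel]

lemma sections_conj_rotA (f : AutT p) (c : ZMod p) (x : Fin p) :
    sections (rotA c * f * (rotA c)⁻¹) x = sections f (x - vertex p c) := by
  rw [← rotA_neg, sections_mul, sections_mul, sections_rotA, sections_rotA, root_rotA, rot_apply,
    map_neg, mul_one, one_mul, sub_eq_add_neg]

end Rotations

section DefiningVectors

variable {p r : ℕ} {e : Fin r → Fin (p - 1) → ZMod p}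

/-- Extension of a defining vector by zero at the last vertex. -/
def hat (p : ℕ) : (Fin (p - 1) → ZMod p) →ₗ[ZMod p] (Fin p → ZMod p) where
  toFun v i := if h : (i : ℕ) < p - 1 then v ⟨i, h⟩ else 0
  map_add' v w := by
    funext i
    by_cases h : (i : ℕ) < p - 1 <;> simp [h]
  map_smul' c v := by
    funext i
    by_cases h : (i : ℕ) < p - 1 <;> simp [h]

lemma hat_apply (v : Fin (p - 1) → ZMod p) (i : Fin p) :
    hat p v i = if h : (i : ℕ) < p - 1 then v ⟨i, h⟩ else 0 := rfl

lemma exists_ne_zero_hat_eq_zero (he : LinearIndependent (ZMod p) e) (hr : 2 ≤ r)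
    (hp : p.Prime) (k : Fin p) :
    ∃ w ∈ Submodule.span (ZMod p) (Set.range e), w ≠ 0 ∧ hat p w k = 0 := by
  have : Fact p.Prime := ⟨hp⟩
  have hmem : ∀ i, e i ∈ Submodule.span (ZMod p) (Set.range e) :=
    fun i => Submodule.subset_span ⟨i, rfl⟩
  let i : Fin r := ⟨0, by omega⟩
  let j : Fin r := ⟨1, by omega⟩
  have hij : i ≠ j := by simp [i, j]
  by_cases h0 : hat p (e i) k = 0
  · exact ⟨e i, hmem i, he.ne_zero i, h0⟩
  · refine ⟨hat p (e i) k • e j - hat p (e j) k • e i,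
      Submodule.sub_mem _ (Submodule.smul_mem _ _ (hmem j)) (Submodule.smul_mem _ _ (hmem i)),
      fun h => h0 ?_, ?_⟩
    · have hpair : LinearIndependent (ZMod p) ![e i, e j] := by
        have hc := he.comp ![i, j] (by
          intro x y
          fin_cases x <;> fin_cases y <;> simp [hij, hij.symm])
        convert! hc using 1
        funext x
        fin_cases x <;> rfl
      exact (LinearIndependent.pair_iff.1 hpair (-hat p (e j) k) (hat p (e i) k)
        (by rw [neg_smul, neg_add_eq_sub, h])).2
    · simp [mul_comm]

lemma root_directed (v : Fin (p - 1) → ZMod p) : directed v [] = 1 := rfl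

end DefiningVectors

section Directed

variable {p : ℕ} [NeZero p]

/-- The last level-one vertex, along which the directed automorphisms are directed. -/
def lastV (p : ℕ) [NeZero p] : Fin p := ⟨p - 1, Nat.sub_one_lt (NeZero.ne p)⟩

lemma lt_of_ne_lastV {i : Fin p} (h : i ≠ lastV p) : (i : ℕ) < p - 1 := by
  have h1 : (i : ℕ) ≠ p - 1 := fun h' => h (Fin.ext h')
  have h2 := i.isLt
  omega

lemma hat_lastV (v : Fin (p - 1) → ZMod p) : hat p v (lastV p) = 0 := by
  simp [hat_apply, lastV]

lemma exists_hat_ne_zero {v : Fin (p - 1) → ZMod p} (hv : v ≠ 0) :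
    ∃ m, m ≠ lastV p ∧ hat p v m ≠ 0 := by
  obtain ⟨x, hx⟩ := Function.ne_iff.1 hv
  have hm : hat p v ⟨x, lt_of_lt_of_le x.isLt (Nat.sub_le p 1)⟩ ≠ 0 := by
    simpa [hat_apply] using hx
  exact ⟨_, fun h => hm (by rw [h]; exact hat_lastV v), hm⟩

lemma hat_injective : Function.Injective (hat p) := by
  rw [injective_iff_map_eq_zero]
  intro v hv
  by_contra h
  obtain ⟨m, -, hm⟩ := exists_hat_ne_zero h
  exact hm (congrFun hv m)

lemma sections_directed_lastV (v : Fin (p - 1) → ZMod p) :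
    sections (directed v) (lastV p) = directed v := by
  funext w
  show directedAux v (lastV p :: w) = directedAux v w
  simp [directedAux, lastV]

lemma sections_directed (v : Fin (p - 1) → ZMod p) {i : Fin p} (hi : i ≠ lastV p) :
    sections (directed v) i = rotA (hat p v i) := by
  have h := lt_of_ne_lastV hi
  funext w
  show directedAux v (i :: w) = rooted (rot (hat p v i)) w
  simp [directedAux, h, hat_apply, rooted, finRotate_pow_val]

lemma directed_add (v w : Fin (p - 1) → ZMod p) :
    directed (v + w) = directed v * directed w := by
  funext l
  induction l with
  | nil => rfl
  | cons x l ih =>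
    show sections (directed (v + w)) x l = sections (directed v * directed w) x l
    rw [sections_mul_of_root _ (root_directed w)]
    by_cases hx : x = lastV p
    · subst hx
      simpa only [sections_directed_lastV] using ih
    · rw [sections_directed _ hx, sections_directed _ hx, sections_directed _ hx, ← rotA_add,
        map_add, Pi.add_apply]

lemma directed_zero : directed (0 : Fin (p - 1) → ZMod p) = 1 := by
  have h := directed_add (0 : Fin (p - 1) → ZMod p) 0
  rw [add_zero] at h
  exact right_eq_mul.1 h

lemma directed_neg (v : Fin (p - 1) → ZMod p) : directed (-v) = (directed v)⁻¹ := by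
  rw [eq_inv_iff_mul_eq_one, ← directed_add, neg_add_cancel, directed_zero]

lemma commute_directed (v w : Fin (p - 1) → ZMod p) : Commute (directed v) (directed w) := by
  rw [commute_iff_eq, ← directed_add, ← directed_add, add_comm]

lemma commute_rotA (c d : ZMod p) : Commute (rotA c) (rotA d) := by
  rw [commute_iff_eq, ← rotA_add, ← rotA_add, add_comm]

/-- The conjugate of `b_v` whose directed section lies at the vertex `y - i + lastV`, so that its
section at `y` is the section of `b_v` at `i`. -/
def shifted (v : Fin (p - 1) → ZMod p) (i y : Fin p) : AutT p :=
  rotA ((vertex p).symm (y - i)) * directed v * (rotA ((vertex p).symm (y - i)))⁻¹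

lemma root_shifted (v : Fin (p - 1) → ZMod p) (i y : Fin p) : shifted v i y [] = 1 :=
  root_conj_rotA (root_directed v) _

lemma sections_shifted (v : Fin (p - 1) → ZMod p) (i y x : Fin p) :
    sections (shifted v i y) x = sections (directed v) (x - (y - i)) := by
  rw [shifted, sections_conj_rotA, AddEquiv.apply_symm_apply]

lemma sections_shifted_self (v : Fin (p - 1) → ZMod p) (i y : Fin p) :
    sections (shifted v i y) y = sections (directed v) i := by
  rw [sections_shifted, sub_sub_cancel]

end Directed

section MultiGGS

variable {p r : ℕ} [NeZero p] {e : Fin r → Fin (p - 1) → ZMod p}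

lemma rotA_mem (e : Fin r → Fin (p - 1) → ZMod p) (c : ZMod p) : rotA c ∈ multiGGS p e := by
  rw [← ZMod.natCast_zmod_val c, rotA_natCast]
  have ha : rootedA p ∈ multiGGS p e := Subgroup.subset_closure (Or.inl rfl)
  exact pow_mem ha _

lemma directed_mem {v : Fin (p - 1) → ZMod p}
    (hv : v ∈ Submodule.span (ZMod p) (Set.range e)) : directed v ∈ multiGGS p e := by
  let S : AddSubgroup (Fin (p - 1) → ZMod p) :=
    { carrier := {v | directed v ∈ multiGGS p e}
      zero_mem' := by
        show directed 0 ∈ multiGGS p e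
        rw [directed_zero]; exact one_mem _
      add_mem' := fun {v w} hv hw => by
        show directed (v + w) ∈ multiGGS p e
        rw [directed_add]; exact mul_mem hv hw
      neg_mem' := fun {v} hv => by
        show directed (-v) ∈ multiGGS p e
        rw [directed_neg]; exact inv_mem hv }
  have h : Submodule.span (ZMod p) (Set.range e) ≤ AddSubgroup.toZModSubmodule p S := by
    rw [Submodule.span_le]
    rintro _ ⟨i, rfl⟩
    exact Subgroup.subset_closure (Or.inr ⟨i, rfl⟩)
  exact h hv

lemma shifted_mul_inv_mem {v : Fin (p - 1) → ZMod p}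
    (hv : v ∈ Submodule.span (ZMod p) (Set.range e)) (i j y : Fin p) :
    shifted v i y * (shifted v j y)⁻¹ ∈ ⁅multiGGS p e, multiGGS p e⁆ := by
  have h : ∀ i, ⁅rotA ((vertex p).symm (y - i)), directed v⁆ ∈ ⁅multiGGS p e, multiGGS p e⁆ :=
    fun i => commutator_mem_commutator (rotA_mem e _) (directed_mem hv)
  have key : shifted v i y * (shifted v j y)⁻¹ = ⁅rotA ((vertex p).symm (y - i)), directed v⁆ *
      ⁅rotA ((vertex p).symm (y - j)), directed v⁆⁻¹ := by
    rw [shifted, shifted, commutatorElement_def, commutatorElement_def]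
    group
  rw [key]
  exact mul_mem (h i) (inv_mem (h j))

/-- Every element of `G` is the section at `y` of an element of `G'` fixing the first level. -/
lemma exists_derived_section (he : LinearIndependent (ZMod p) e) (hr : 2 ≤ r) (hp : p.Prime)
    (y : Fin p) {g : AutT p} (hg : g ∈ multiGGS p e) :
    ∃ h ∈ ⁅multiGGS p e, multiGGS p e⁆, h [] = 1 ∧ sections h y = g := by
  have : Fact p.Prime := ⟨hp⟩
  have inv_root : ∀ {h : AutT p}, h [] = 1 → h⁻¹ [] = 1 := fun {h} hh => by
    rw [root_inv, hh, inv_one]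
  obtain ⟨k, hk⟩ : ∃ k, k ≠ lastV p := by
    have : Nontrivial (Fin p) := Fin.nontrivial_iff_two_le.2 hp.two_le
    exact exists_ne _
  obtain ⟨w, hw, hw0, hwk⟩ := exists_ne_zero_hat_eq_zero he hr hp k
  obtain ⟨l, hl, hwl⟩ := exists_hat_ne_zero hw0
  have hrot : ∀ c : ZMod p, ∃ h ∈ ⁅multiGGS p e, multiGGS p e⁆, h [] = 1 ∧
      sections h y = rotA c := fun c => by
    have hv := Submodule.smul_mem _ (c * (hat p w l)⁻¹) hw
    refine ⟨_, shifted_mul_inv_mem hv l k y, ?_, ?_⟩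
    · rw [root_mul, root_shifted, inv_root (root_shifted _ _ _), one_mul]
    · rw [sections_mul_of_root _ (inv_root (root_shifted _ _ _)),
        sections_inv_of_root (root_shifted _ _ _), sections_shifted_self, sections_shifted_self,
        sections_directed _ hl, sections_directed _ hk, map_smul, Pi.smul_apply, Pi.smul_apply,
        hwk, smul_zero, rotA_zero, inv_one, mul_one, smul_eq_mul, inv_mul_cancel_right₀ hwl]
  induction hg using closure_induction with
  | mem x hx =>
    rcases hx with hx | ⟨i, rfl⟩
    · obtain rfl : x = rootedA p := hx
      rw [← rotA_one]
      exact hrot 1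
    · have hv : e i ∈ Submodule.span (ZMod p) (Set.range e) := Submodule.subset_span ⟨i, rfl⟩
      obtain ⟨h, hG, h1, hs⟩ := hrot (hat p (e i) l)
      refine ⟨_, mul_mem (shifted_mul_inv_mem hv (lastV p) l y) hG, ?_, ?_⟩
      · rw [root_mul, root_mul, root_shifted, inv_root (root_shifted _ _ _), h1, one_mul, one_mul]
      · rw [sections_mul_of_root _ h1, sections_mul_of_root _ (inv_root (root_shifted _ _ _)),
          sections_inv_of_root (root_shifted _ _ _), sections_shifted_self, sections_shifted_self,
          sections_directed_lastV, sections_directed _ hl, hs, inv_mul_cancel_right]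
  | one => exact ⟨1, one_mem _, rfl, rfl⟩
  | mul x z _ _ hx hz =>
    obtain ⟨h, hG, h1, rfl⟩ := hx
    obtain ⟨h', hG', h1', rfl⟩ := hz
    exact ⟨h * h', mul_mem hG hG', by rw [root_mul, h1, h1', one_mul],
      sections_mul_of_root _ h1' y⟩
  | inv x _ hx =>
    obtain ⟨h, hG, h1, rfl⟩ := hx
    exact ⟨h⁻¹, inv_mem hG, inv_root h1, sections_inv_of_root h1 y⟩

/-- The commutator subgroup of a closure is contained in every subgroup normalized by the closure
and containing the commutators of the generators. -/
lemma commutator_closure_le {Γ : Type*} [Group Γ] {S : Set Γ} {N : Subgroup Γ}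
    (hN : ∀ g ∈ closure S, ∀ n ∈ N, g * n * g⁻¹ ∈ N)
    (h : ∀ s ∈ S, ∀ t ∈ S, ⁅s, t⁆ ∈ N) : ⁅closure S, closure S⁆ ≤ N := by
  have hN' : ∀ g ∈ closure S, ∀ n ∈ N, g⁻¹ * n * g ∈ N := fun g hg n hn => by
    simpa using hN g⁻¹ (inv_mem hg) n hn
  have comm : ∀ {g k : Γ}, ⁅g, k⁆ ∈ N → ⁅k, g⁆ ∈ N := fun {g k} hgk => by
    rw [← commutatorElement_inv]; exact inv_mem hgk
  have extend : ∀ g : Γ, (∀ s ∈ S, ⁅g, s⁆ ∈ N) → ∀ k ∈ closure S, ⁅g, k⁆ ∈ N := by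
    intro g hg k hk
    induction hk using closure_induction with
    | mem x hx => exact hg x hx
    | one => rw [commutatorElement_one_right]; exact one_mem _
    | mul x y hx _ ihx ihy =>
      have e : ⁅g, x * y⁆ = ⁅g, x⁆ * (x * ⁅g, y⁆ * x⁻¹) := by
        simp only [commutatorElement_def]; group
      rw [e]
      exact mul_mem ihx (hN x hx _ ihy)
    | inv x hx ih =>
      rw [commutatorElement_inv_right]
      exact hN' x hx _ (comm ih)
  rw [commutator_le]
  intro g hg k hk
  exact extend g (fun s hs => comm (extend s (h s hs) g hg)) k hk

lemma commutator_directed_shifted_mem {u v : Fin (p - 1) → ZMod p}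
    (hu : u ∈ Submodule.span (ZMod p) (Set.range e))
    (hv : v ∈ Submodule.span (ZMod p) (Set.range e)) (i y : Fin p) :
    ⁅directed u, shifted v i y⁆ ∈ ⁅⁅multiGGS p e, multiGGS p e⁆, multiGGS p e⁆ := by
  set c := rotA ((vertex p).symm (y - i)) with hc
  have h1 : shifted v i y = ⁅c, directed v⁆ * directed v := by
    rw [shifted, ← hc, commutatorElement_def]; group
  have h2 : ⁅directed u, shifted v i y⁆ = ⁅directed u, ⁅c, directed v⁆⁆ := by
    rw [h1]
    generalize ⁅c, directed v⁆ = d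
    have h3 : ⁅directed u, d * directed v⁆ =
        ⁅directed u, d⁆ * (d * ⁅directed u, directed v⁆ * d⁻¹) := by
      simp only [commutatorElement_def]; group
    rw [h3, (commute_directed u v).commutator_eq, mul_one, mul_inv_cancel, mul_one]
  rw [h2, commutator_comm]
  exact commutator_mem_commutator (directed_mem hu)
    (commutator_mem_commutator (rotA_mem e _) (directed_mem hv))

/-- The basic commutator with a single nontrivial section. -/
lemma atPos_commutator_mem_of_hat {u v : Fin (p - 1) → ZMod p}
    (hu : u ∈ Submodule.span (ZMod p) (Set.range e))
    (hv : v ∈ Submodule.span (ZMod p) (Set.range e)) {k : Fin p} (hk : k ≠ lastV p)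
    (huk : hat p u k = 0) (hvk : hat p v (lastV p + lastV p - k) = 1) :
    atPos (lastV p) ⁅directed u, rootedA p⁆ ∈ ⁅⁅multiGGS p e, multiGGS p e⁆, multiGGS p e⁆ := by
  have hne : lastV p + lastV p - k ≠ lastV p := fun h => hk <| by
    rw [sub_eq_iff_eq_add] at h
    exact (add_left_cancel h).symm
  have h := commutator_directed_shifted_mem hu hv (lastV p) k
  have hsec : ∀ x, sections ⁅directed u, shifted v (lastV p) k⁆ x =
      ⁅sections (directed u) x, sections (directed v) (x - (k - lastV p))⁆ := fun x => by
    rw [sections_commutator (root_directed u) (root_shifted _ _ _), sections_shifted]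
  rwa [eq_atPos (root_commutator (root_directed u) _) (x := lastV p)
    (g := ⁅directed u, rootedA p⁆) ?_ ?_] at h
  · have hx : lastV p - (k - lastV p) = lastV p + lastV p - k := by abel
    rw [hsec, sections_directed_lastV, hx, sections_directed _ hne, hvk, rotA_one]
  · intro x hx
    rw [hsec, sections_directed _ hx]
    by_cases hxk : x = k
    · rw [hxk, huk, rotA_zero, commutatorElement_one_left]
    · have hne' : x - (k - lastV p) ≠ lastV p := fun h => hxk <| by
        rw [sub_eq_iff_eq_add, add_sub_cancel] at h
        exact h
      rw [sections_directed _ hne', (commute_rotA _ _).commutator_eq]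

lemma conj_atPos_mem (he : LinearIndependent (ZMod p) e) (hr : 2 ≤ r) (hp : p.Prime)
    (y : Fin p) {g c : AutT p} (hg : g ∈ multiGGS p e)
    (hc : atPos y c ∈ ⁅⁅multiGGS p e, multiGGS p e⁆, multiGGS p e⁆) :
    atPos y (g * c * g⁻¹) ∈ ⁅⁅multiGGS p e, multiGGS p e⁆, multiGGS p e⁆ := by
  obtain ⟨h, hG, h1, rfl⟩ := exists_derived_section he hr hp y hg
  rw [← conj_atPos h1]
  exact (normalizer_commutator_ge_right _ _ (commutator_le_self _ hG) _).1 hc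

lemma atPos_commutator_directed_mem (he : LinearIndependent (ZMod p) e) (hr : 2 ≤ r)
    (hp : p.Prime) {u : Fin (p - 1) → ZMod p}
    (hu : u ∈ Submodule.span (ZMod p) (Set.range e)) :
    atPos (lastV p) ⁅directed u, rootedA p⁆ ∈ ⁅⁅multiGGS p e, multiGGS p e⁆, multiGGS p e⁆ := by
  have : Fact p.Prime := ⟨hp⟩
  set E := Submodule.span (ZMod p) (Set.range e) with hE
  set K := ⁅⁅multiGGS p e, multiGGS p e⁆, multiGGS p e⁆ with hK
  have add_mem : ∀ {v w}, v ∈ E → atPos (lastV p) ⁅directed v, rootedA p⁆ ∈ K →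
      atPos (lastV p) ⁅directed w, rootedA p⁆ ∈ K →
      atPos (lastV p) ⁅directed (v + w), rootedA p⁆ ∈ K := by
    intro v w hvE hv hw
    have h : ⁅directed (v + w), rootedA p⁆ =
        directed v * ⁅directed w, rootedA p⁆ * (directed v)⁻¹ * ⁅directed v, rootedA p⁆ := by
      rw [directed_add]; simp only [commutatorElement_def]; group
    rw [h, map_mul]
    exact mul_mem (conj_atPos_mem he hr hp _ (directed_mem hvE) hw) hv
  have opp_ne : ∀ {k : Fin p}, k ≠ lastV p → lastV p + lastV p - k ≠ lastV p := by
    intro k hk h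
    rw [sub_eq_iff_eq_add] at h
    exact hk (add_left_cancel h).symm
  have base : ∀ {m : Fin p} {u v}, u ∈ E → v ∈ E → m ≠ lastV p → hat p v m ≠ 0 →
      hat p u (lastV p + lastV p - m) = 0 → atPos (lastV p) ⁅directed u, rootedA p⁆ ∈ K := by
    intro m u v hu hv hm hvm hum
    refine atPos_commutator_mem_of_hat hu (E.smul_mem (hat p v m)⁻¹ hv) (opp_ne hm) hum ?_
    rw [sub_sub_cancel, map_smul, Pi.smul_apply, smul_eq_mul, inv_mul_cancel₀ hvm]
  obtain ⟨v₀, hv₀, hv₀0, -⟩ := exists_ne_zero_hat_eq_zero he hr hp 0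
  obtain ⟨k, hk, hv₀k⟩ := exists_hat_ne_zero hv₀0
  obtain ⟨w, hw, hw0, hwk⟩ :=
    exists_ne_zero_hat_eq_zero he hr hp (lastV p + lastV p - k)
  have hwK : ∀ c : ZMod p, atPos (lastV p) ⁅directed (c • w), rootedA p⁆ ∈ K := fun c =>
    base (E.smul_mem c hw) hv₀ hk hv₀k (by rw [map_smul, Pi.smul_apply, hwk, smul_zero])
  obtain ⟨m, hm, hwm⟩ := exists_hat_ne_zero hw0
  by_cases hall : hat p u (lastV p + lastV p - m) = 0
  · exact base hu hw hm hwm hall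
  · have hdiff : u = (hat p u m / hat p w m) • w + (u - (hat p u m / hat p w m) • w) := by abel
    rw [hdiff]
    refine add_mem (E.smul_mem _ hw) (hwK _) ?_
    refine base (m := lastV p + lastV p - m) (E.sub_mem hu (E.smul_mem _ hw)) hu (opp_ne hm)
      hall ?_
    rw [sub_sub_cancel, map_sub, map_smul, Pi.sub_apply, Pi.smul_apply, smul_eq_mul,
      div_mul_cancel₀ _ hwm, sub_self]

/-- `γ₃(G)` contains `ψ⁻¹(G' × ⋯ × G')`. -/
lemma atPos_mem_lower (he : LinearIndependent (ZMod p) e) (hr : 2 ≤ r) (hp : p.Prime)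
    (y : Fin p) {c : AutT p} (hc : c ∈ ⁅multiGGS p e, multiGGS p e⁆) :
    atPos y c ∈ ⁅⁅multiGGS p e, multiGGS p e⁆, multiGGS p e⁆ := by
  set K := ⁅⁅multiGGS p e, multiGGS p e⁆, multiGGS p e⁆ with hK
  have hlast : ∀ c ∈ ⁅multiGGS p e, multiGGS p e⁆, atPos (lastV p) c ∈ K := by
    have hb : ∀ i, ⁅directed (e i), rootedA p⁆ ∈ K.comap (atPos (lastV p)) := fun i =>
      atPos_commutator_directed_mem he hr hp (Submodule.subset_span ⟨i, rfl⟩)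
    refine commutator_closure_le (N := K.comap (atPos (lastV p)))
      (fun g hg n hn => conj_atPos_mem he hr hp _ hg hn) ?_
    rintro _ (rfl | ⟨i, rfl⟩) _ (rfl | ⟨j, rfl⟩)
    · rw [commutatorElement_self]; exact one_mem _
    · rw [← commutatorElement_inv]; exact inv_mem (hb j)
    · exact hb i
    · rw [(commute_directed _ _).commutator_eq]; exact one_mem _
  set d := (vertex p).symm (y - lastV p) with hd
  have hconj : rotA d * atPos (lastV p) c * (rotA d)⁻¹ = atPos y c := by
    refine eq_atPos (root_conj_rotA rfl _) ?_ fun x hx => ?_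
    · rw [sections_conj_rotA, hd, AddEquiv.apply_symm_apply, sub_sub_cancel, sections_atPos,
        Pi.mulSingle_eq_same]
    · have hne : x - (y - lastV p) ≠ lastV p := fun h => hx <| by
        rw [sub_eq_iff_eq_add, add_sub_cancel] at h
        exact h
      rw [sections_conj_rotA, hd, AddEquiv.apply_symm_apply, sections_atPos,
        Pi.mulSingle_eq_of_ne hne]
  rw [← hconj]
  exact (normalizer_commutator_ge_right _ _ (rotA_mem e d) _).1 (hlast c hc)

/-- `G''` contains `ψ⁻¹(γ₃(G) × ⋯ × γ₃(G))`. -/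
lemma atPos_mem_second_derived (he : LinearIndependent (ZMod p) e) (hr : 2 ≤ r) (hp : p.Prime)
    (y : Fin p) {c : AutT p} (hc : c ∈ ⁅⁅multiGGS p e, multiGGS p e⁆, multiGGS p e⁆) :
    atPos y c ∈ ⁅⁅multiGGS p e, multiGGS p e⁆, ⁅multiGGS p e, multiGGS p e⁆⁆ := by
  have h : ⁅⁅multiGGS p e, multiGGS p e⁆, multiGGS p e⁆ ≤
      (⁅⁅multiGGS p e, multiGGS p e⁆, ⁅multiGGS p e, multiGGS p e⁆⁆).comap (atPos y) := by
    rw [commutator_le]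
    intro c hc g hg
    obtain ⟨h, hG, h1, rfl⟩ := exists_derived_section he hr hp y hg
    rw [mem_comap, ← commutator_atPos h1]
    exact commutator_mem_commutator
      (commutator_mono (commutator_le_self _) le_rfl (atPos_mem_lower he hr hp y hc)) hG
  exact h hc

/-- `Represents e g v` says that `g` is a product of powers of `a` and of directed generators
whose total exponent vector is `v`. -/
inductive Represents (e : Fin r → Fin (p - 1) → ZMod p) :
    AutT p → (Fin (p - 1) → ZMod p) → Prop
  | rotation (c : ZMod p) : Represents e (rotA c) 0
  | directional {v : Fin (p - 1) → ZMod p} (hv : v ∈ Submodule.span (ZMod p) (Set.range e)) :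
      Represents e (directed v) v
  | mul {g h : AutT p} {v w : Fin (p - 1) → ZMod p} :
      Represents e g v → Represents e h w → Represents e (g * h) (v + w)

namespace Represents

lemma one : Represents e 1 0 := by
  have h := Represents.rotation (e := e) 0
  rwa [rotA_zero] at h

lemma inv {g : AutT p} {v : Fin (p - 1) → ZMod p} (h : Represents e g v) :
    Represents e g⁻¹ (-v) := by
  induction h with
  | rotation c =>
    rw [← rotA_neg, neg_zero]
    exact .rotation _
  | directional hv =>
    rw [← directed_neg]
    exact .directional (Submodule.neg_mem _ hv)
  | mul _ _ ihg ihh =>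
    rw [mul_inv_rev, neg_add_rev]
    exact ihh.mul ihg

lemma mem_span {g : AutT p} {v : Fin (p - 1) → ZMod p} (h : Represents e g v) :
    v ∈ Submodule.span (ZMod p) (Set.range e) := by
  induction h with
  | rotation c => exact Submodule.zero_mem _
  | directional hv => exact hv
  | mul _ _ ihg ihh => exact Submodule.add_mem _ ihg ihh

lemma mem {g : AutT p} {v : Fin (p - 1) → ZMod p} (h : Represents e g v) :
    g ∈ multiGGS p e := by
  induction h with
  | rotation c => exact rotA_mem e c
  | directional hv => exact directed_mem hv
  | mul _ _ ihg ihh => exact mul_mem ihg ihh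

lemma exists_root {g : AutT p} {v : Fin (p - 1) → ZMod p} (h : Represents e g v) :
    ∃ c, g [] = rot c := by
  induction h with
  | rotation c => exact ⟨c, rfl⟩
  | directional hv => exact ⟨0, rot_zero.symm⟩
  | mul _ _ ihg ihh =>
    obtain ⟨c, hc⟩ := ihg
    obtain ⟨d, hd⟩ := ihh
    exact ⟨c + d, by rw [root_mul, hc, hd, rot_add]⟩

/-- The sections of an element are represented by vectors with the same total, and these vectors
determine the action of the sections on the first level. -/
lemma exists_sections {g : AutT p} {v : Fin (p - 1) → ZMod p} (h : Represents e g v) :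
    ∃ w : Fin p → Fin (p - 1) → ZMod p, (∀ i, Represents e (sections g i) (w i)) ∧
      ∑ i, w i = v ∧
      ∀ i, sections g i [] = rot (∑ j, hat p (w j) (i - (j - lastV p))) := by
  induction h with
  | rotation c =>
    refine ⟨0, fun i => one, by simp, fun i => ?_⟩
    simp [sections_rotA, root_one, rot_zero]
  | @directional v hv =>
    refine ⟨Pi.single (lastV p) v, fun i => ?_, ?_, fun i => ?_⟩
    · by_cases hi : i = lastV p
      · subst hi
        rw [sections_directed_lastV, Pi.single_eq_same]
        exact .directional hv
      · rw [sections_directed _ hi, Pi.single_eq_of_ne hi]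
        exact .rotation _
    · rw [Finset.sum_pi_single']
      simp
    · rw [Finset.sum_eq_single (lastV p) (fun j _ hj => by
        rw [Pi.single_eq_of_ne hj, map_zero, Pi.zero_apply]) (by simp), Pi.single_eq_same,
        sub_self, sub_zero]
      by_cases hi : i = lastV p
      · subst hi
        rw [sections_directed_lastV, hat_lastV, rot_zero, root_directed]
      · rw [sections_directed _ hi, root_rotA]
  | @mul g h v v' _ hh ihg ihh =>
    obtain ⟨w, hw, hws, hwr⟩ := ihg
    obtain ⟨w', hw', hws', hwr'⟩ := ihh
    obtain ⟨c, hc⟩ := hh.exists_root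
    refine ⟨fun i => w (h [] i) + w' i, fun i => ?_, ?_, fun i => ?_⟩
    · rw [sections_mul]
      exact (hw _).mul (hw' i)
    · rw [Finset.sum_add_distrib, Equiv.sum_comp (h []) w, hws, hws']
    · rw [sections_mul, root_mul, hwr, hwr', ← rot_add]
      congr 1
      simp only [map_add, Pi.add_apply, Finset.sum_add_distrib]
      congr 1
      rw [← Equiv.sum_comp (h [])]
      refine Finset.sum_congr rfl fun j _ => ?_
      rw [hc, rot_apply, rot_apply]
      refine congrArg (hat p _) ?_
      abel

lemma exists_eq_mul {g : AutT p} {v : Fin (p - 1) → ZMod p} (h : Represents e g v) :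
    ∃ c, ∃ d ∈ ⁅multiGGS p e, multiGGS p e⁆, g = d * rotA c * directed v := by
  set G := multiGGS p e with hG
  have conj_mem : ∀ {x d : AutT p}, x ∈ G → d ∈ ⁅G, G⁆ → x * d * x⁻¹ ∈ ⁅G, G⁆ :=
    fun {x d} hx hd => (normalizer_commutator_ge_right G G hx d).1 hd
  induction h with
  | rotation c => exact ⟨c, 1, one_mem _, by rw [directed_zero, one_mul, mul_one]⟩
  | directional hv => exact ⟨0, 1, one_mem _, by rw [rotA_zero, one_mul, one_mul]⟩
  | @mul g h v w hg hh ihg ihh =>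
    obtain ⟨c, d, hd, hgd⟩ := ihg
    obtain ⟨c', d', hd', hhd⟩ := ihh
    have hb : directed v ∈ G := directed_mem hg.mem_span
    refine ⟨c + c', d * ((rotA c * directed v) * d' * (rotA c * directed v)⁻¹) *
      (rotA c * ⁅directed v, rotA c'⁆ * (rotA c)⁻¹), ?_, ?_⟩
    · exact mul_mem (mul_mem hd (conj_mem (mul_mem (rotA_mem e c) hb) hd'))
        (conj_mem (rotA_mem e c) (commutator_mem_commutator hb (rotA_mem e c')))
    · rw [hgd, hhd, rotA_add, directed_add, commutatorElement_def]
      group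

end Represents

lemma exists_represents {g : AutT p} (hg : g ∈ multiGGS p e) : ∃ v, Represents e g v := by
  induction hg using closure_induction with
  | mem x hx =>
    rcases hx with hx | ⟨i, rfl⟩
    · obtain rfl : x = rootedA p := hx
      rw [← rotA_one]
      exact ⟨0, .rotation 1⟩
    · exact ⟨e i, .directional (Submodule.subset_span ⟨i, rfl⟩)⟩
  | one => exact ⟨0, .one⟩
  | mul x y _ _ hx hy =>
    obtain ⟨v, hv⟩ := hx
    obtain ⟨w, hw⟩ := hy
    exact ⟨v + w, hv.mul hw⟩
  | inv x _ hx =>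
    obtain ⟨v, hv⟩ := hx
    exact ⟨-v, hv.inv⟩

lemma Represents.mem_derived {g : AutT p} (h : Represents e g 0) (hg : g [] = 1) :
    g ∈ ⁅multiGGS p e, multiGGS p e⁆ := by
  obtain ⟨c, d, hd, rfl⟩ := h.exists_eq_mul
  rw [directed_zero, mul_one] at hg ⊢
  have hker : ⁅multiGGS p e, multiGGS p e⁆ ≤ (rootHom p).ker := by
    rw [commutator_le]
    intro x hx y hy
    obtain ⟨_, hx⟩ := exists_represents hx
    obtain ⟨_, hy⟩ := exists_represents hy
    obtain ⟨s, hs⟩ := hx.exists_root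
    obtain ⟨t, ht⟩ := hy.exists_root
    rw [MonoidHom.mem_ker, map_commutatorElement, rootHom_apply, rootHom_apply, hs, ht,
      commutatorElement_eq_one_iff_mul_comm, ← rot_add, ← rot_add, add_comm]
  have hd1 : d [] = 1 := hker hd
  rw [root_mul, hd1, one_mul, root_rotA] at hg
  rwa [rot_eq_one hg, rotA_zero, mul_one]

/-- The exponent vectors of the elements of `st_G(n)`. -/
def exponents (e : Fin r → Fin (p - 1) → ZMod p) (n : ℕ) :
    Submodule (ZMod p) (Fin (p - 1) → ZMod p) :=
  AddSubgroup.toZModSubmodule p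
    { carrier := {v | ∃ g ∈ levelStab p n, Represents e g v}
      zero_mem' := ⟨1, one_mem _, .one⟩
      add_mem' := fun ⟨g, hg, hv⟩ ⟨h, hh, hw⟩ => ⟨g * h, mul_mem hg hh, hv.mul hw⟩
      neg_mem' := fun ⟨g, hg, hv⟩ => ⟨g⁻¹, inv_mem hg, hv.inv⟩ }

lemma mem_exponents {n : ℕ} {v : Fin (p - 1) → ZMod p} :
    v ∈ exponents e n ↔ ∃ g ∈ levelStab p n, Represents e g v := Iff.rfl

lemma exponents_le_span (n : ℕ) : exponents e n ≤ Submodule.span (ZMod p) (Set.range e) := by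
  rintro v ⟨g, -, hv⟩
  exact hv.mem_span

lemma exists_of_mem_exponents_succ {n : ℕ} {v : Fin (p - 1) → ZMod p}
    (hv : v ∈ exponents e (n + 1)) :
    ∃ w : Fin p → Fin (p - 1) → ZMod p, (∀ i, w i ∈ exponents e n) ∧ ∑ i, w i = v ∧
      (n ≠ 0 → ∀ i, ∑ j, hat p (w j) (i - (j - lastV p)) = 0) := by
  obtain ⟨g, hg, hv⟩ := hv
  obtain ⟨w, hw, hs, hr⟩ := hv.exists_sections
  refine ⟨w, fun i => ⟨_, sections_mem_levelStab hg i, hw i⟩, hs, fun hn i => ?_⟩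
  obtain ⟨m, rfl⟩ := Nat.exists_eq_succ_of_ne_zero hn
  refine rot_eq_one ?_
  rw [← hr i]
  exact root_eq_one_of_mem_levelStab (sections_mem_levelStab hg i)

lemma exponents_succ_le (n : ℕ) : exponents e (n + 1) ≤ exponents e n := by
  intro v hv
  obtain ⟨w, hw, rfl, -⟩ := exists_of_mem_exponents_succ hv
  exact Submodule.sum_mem _ fun i _ => hw i

/-- The cyclic shift of functions on the first level. -/
def shiftMap (p : ℕ) [NeZero p] : Module.End (ZMod p) (Fin p → ZMod p) :=
  LinearMap.funLeft (ZMod p) (ZMod p) (fun i => i - vertex p 1)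

lemma shiftMap_pow_apply (n : ℕ) (f : Fin p → ZMod p) (i : Fin p) :
    (shiftMap p ^ n) f i = f (i - vertex p (n : ZMod p)) := by
  induction n generalizing i with
  | zero => simp
  | succ n ih =>
    rw [pow_succ', Module.End.mul_apply, shiftMap, LinearMap.funLeft_apply, ← shiftMap, ih,
      Nat.cast_succ, map_add, sub_sub, add_comm]

lemma one_sub_shiftMap_pow (hp : p.Prime) : (1 - shiftMap p) ^ p = 0 := by
  have : Fact p.Prime := ⟨hp⟩
  have : CharP (Module.End (ZMod p) (Fin p → ZMod p)) p :=
    charP_of_injective_algebraMap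
      (FaithfulSMul.algebraMap_injective (ZMod p) (Module.End (ZMod p) (Fin p → ZMod p))) p
  rw [sub_pow_char_of_commute _ (Commute.one_left _), one_pow, sub_eq_zero]
  refine LinearMap.ext fun f => funext fun i => ?_
  rw [shiftMap_pow_apply, ZMod.natCast_self, map_zero, sub_zero]
  rfl

lemma exponents_eq_bot_of_succ_eq (hp : p.Prime) {n : ℕ} (hn : n ≠ 0)
    (h : exponents e (n + 1) = exponents e n) : exponents e n = ⊥ := by
  have hrange : ∀ m : ℕ, ∀ v ∈ exponents e n, ∃ x, hat p v = ((1 - shiftMap p) ^ m) x := by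
    intro m
    induction m with
    | zero => exact fun v _ => ⟨hat p v, rfl⟩
    | succ m ih =>
      intro v hv
      rw [← h] at hv
      obtain ⟨w, hw, hs, hz⟩ := exists_of_mem_exponents_succ hv
      choose x hx using fun j => ih (w j) (hw j)
      let k : Fin p → ℕ := fun j => ((vertex p).symm (j - lastV p)).val
      refine ⟨∑ j, (∑ i ∈ Finset.range (k j), shiftMap p ^ i) (x j), ?_⟩
      have hk : ∀ j f i, (shiftMap p ^ k j) f i = f (i - (j - lastV p)) := fun j f i => by
        rw [shiftMap_pow_apply, ZMod.natCast_zmod_val, AddEquiv.apply_symm_apply]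
      have hsum : hat p v = ∑ j, (1 - shiftMap p ^ k j) (hat p (w j)) := by
        funext i
        rw [← hs, map_sum]
        simp only [LinearMap.sub_apply, Finset.sum_sub_distrib, Pi.sub_apply, Finset.sum_apply, hk,
          hz hn i, sub_zero, Module.End.one_apply]
      rw [hsum, map_sum]
      refine Finset.sum_congr rfl fun j _ => ?_
      rw [hx, ← mul_neg_geom_sum, ← Module.End.mul_apply, ← Module.End.mul_apply, pow_succ']
      have hcomm : Commute (∑ i ∈ Finset.range (k j), shiftMap p ^ i) ((1 - shiftMap p) ^ m) := by
        refine Commute.pow_right (Commute.sum_left _ _ _ fun i _ => ?_) m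
        exact (Commute.one_right _).sub_right ((Commute.refl _).pow_left i)
      rw [mul_assoc, hcomm.eq, mul_assoc]
  rw [eq_bot_iff]
  intro v hv
  obtain ⟨x, hx⟩ := hrange p v hv
  rw [one_sub_shiftMap_pow hp, LinearMap.zero_apply] at hx
  exact hat_injective (hx.trans (map_zero _).symm)

lemma finrank_exponents_le (hp : p.Prime) (n : ℕ) :
    Module.finrank (ZMod p) (exponents e (n + 1)) ≤ r - n := by
  have : Fact p.Prime := ⟨hp⟩
  induction n with
  | zero =>
    refine (Submodule.finrank_mono (exponents_le_span 1)).trans ?_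
    exact (finrank_range_le_card (R := ZMod p) e).trans_eq (Fintype.card_fin r)
  | succ n ih =>
    by_cases h : exponents e (n + 1 + 1) = exponents e (n + 1)
    · rw [h, exponents_eq_bot_of_succ_eq hp n.succ_ne_zero h, finrank_bot]
      exact Nat.zero_le _
    · have hlt := Submodule.finrank_lt_finrank_of_lt
        (lt_of_le_of_ne (exponents_succ_le (e := e) (n + 1)) h)
      omega

/-- `st_G(r+1)` is contained in `G'`. -/
lemma mem_derived_of_mem_levelStab (hp : p.Prime) {g : AutT p}
    (hg : g ∈ levelStab p (r + 1)) (hG : g ∈ multiGGS p e) :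
    g ∈ ⁅multiGGS p e, multiGGS p e⁆ := by
  have : Fact p.Prime := ⟨hp⟩
  obtain ⟨v, hv⟩ := exists_represents hG
  have hbot : exponents e (r + 1) = ⊥ := by
    have h := finrank_exponents_le (e := e) hp r
    rw [Nat.sub_self, Nat.le_zero] at h
    exact Submodule.finrank_eq_zero.1 h
  have h0 : v ∈ exponents e (r + 1) := mem_exponents.2 ⟨g, hg, hv⟩
  rw [hbot, Submodule.mem_bot] at h0
  subst h0
  exact hv.mem_derived (root_eq_one_of_mem_levelStab hg)

lemma sections_mem {g : AutT p} (hg : g ∈ multiGGS p e) (x : Fin p) :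
    sections g x ∈ multiGGS p e := by
  obtain ⟨v, hv⟩ := exists_represents hg
  obtain ⟨w, hw, -⟩ := hv.exists_sections
  exact (hw x).mem

end MultiGGS

end AutT

end TreeAut

/-- For a multi-GGS-group `G` with `r ≥ 2` directed generators,
`G'' ≥ st_G(r+3)`. -/
theorem stab_le_second_derived
    (p r : ℕ) (hp : p.Prime) (hpodd : Odd p) (hr : 2 ≤ r)
    (e : Fin r → Fin (p - 1) → ZMod p) (he : LinearIndependent (ZMod p) e) :
    (levelStab p (r + 3) ⊓ multiGGS p e : Subgroup (AutT p)) ≤ ⁅⁅multiGGS p e, multiGGS p e⁆, ⁅multiGGS p e, multiGGS p e⁆⁆ := by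
  have : NeZero p := ⟨hp.ne_zero⟩
  rintro g ⟨hg, hG⟩
  refine mem_of_atPos_mem (root_eq_one_of_mem_levelStab hg) fun x =>
    atPos_mem_second_derived he hr hp x ?_
  have hx := sections_mem_levelStab hg x
  refine mem_of_atPos_mem (root_eq_one_of_mem_levelStab hx) fun y => atPos_mem_lower he hr hp y ?_
  exact mem_derived_of_mem_levelStab hp (sections_mem_levelStab hx y)
    (sections_mem (sections_mem hG x) y)
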